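/- Stable time-change of a jump kernel: there exists a constant C ≥ 1 such that for all t > 0 and all x, y ∈ E with x ≠ y: (a) if d(x,y) ≤ t^{β/α} then C^{-1} H_{≤1}(t, d(x,y)) ≤ q(t,x,y) ≤ C H_{≤1}(t, d(x,y)); (b) if d(x,y) ≥ t^{β/α} then C^{-1} t^{2β−1} d(x,y)^{−d−α} ≤ q(t,x,y) ≤ C t^{2β−1} d(x,y)^{−d−α}. -/

import Mathlib

open MeasureTheory Filter Set
open scoped ENNReal Topology

/-- The on-diagonal/near-diagonal profile `H_{≤1}(t,r)` of Theorem 1.4. -/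
noncomputable def Hle (α β d t r : ℝ) : ℝ :=
  if d < 2 * α then t ^ (β - 1 - β * d / α)
  else if d = 2 * α then t ^ (-1 - β) * Real.log (2 * t ^ β / r ^ α)
  else t ^ (-1 - β) * r ^ (2 * α - d)

/-- The profile `min (x^(1-k)) (N^(k+1) x^2)` of the time-changed kernel, in factored form. -/
noncomputable def jumpProfile (k N x : ℝ) : ℝ := x ^ (1 - k) * min 1 ((N * x) ^ (k + 1))

lemma measurable_jumpProfile (k N : ℝ) : Measurable (jumpProfile k N) := by
  unfold jumpProfile; fun_prop

lemma jumpProfile_le_rpow {k N x : ℝ} (hx : 0 ≤ x) : jumpProfile k N x ≤ x ^ (1 - k) :=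
  mul_le_of_le_one_right (by positivity) (min_le_left _ _)

lemma rpow_mul_mul_rpow_eq {k N x : ℝ} (hN : 0 ≤ N) (hx : 0 < x) :
    x ^ (1 - k) * (N * x) ^ (k + 1) = N ^ (k + 1) * x ^ 2 := by
  rw [Real.mul_rpow hN hx.le, mul_left_comm, ← Real.rpow_add hx,
    show 1 - k + (k + 1) = 2 by ring, Real.rpow_two]

lemma jumpProfile_le_sq {k N x : ℝ} (hN : 0 ≤ N) (hx : 0 < x) :
    jumpProfile k N x ≤ N ^ (k + 1) * x ^ 2 := by
  rw [← rpow_mul_mul_rpow_eq hN hx]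
  exact mul_le_mul_of_nonneg_left (min_le_right _ _) (by positivity)

lemma jumpProfile_eq_sq {k N x : ℝ} (hk : 0 < k) (hN : 0 ≤ N) (hx : 0 < x) (h : N * x ≤ 1) :
    jumpProfile k N x = N ^ (k + 1) * x ^ 2 := by
  rw [jumpProfile, min_eq_right (Real.rpow_le_one (by positivity) h (by linarith)),
    rpow_mul_mul_rpow_eq hN hx]

lemma jumpProfile_eq_rpow {k N x : ℝ} (hk : 0 < k) (h : 1 ≤ N * x) :
    jumpProfile k N x = x ^ (1 - k) := by
  rw [jumpProfile, min_eq_left (Real.one_le_rpow h (by linarith)), mul_one]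

lemma jumpProfile_mono {k N x : ℝ} (hk : 0 < k) (hN : 1 ≤ N) (hx : 0 < x) :
    jumpProfile k 1 x ≤ jumpProfile k N x := by
  unfold jumpProfile
  gcongr

lemma rpow_mul_jumpProfile_one_le {k N x : ℝ} (hk : 0 < k) (hN0 : 0 < N) (hN : N ≤ 1)
    (hx : 0 < x) : N ^ (k + 1) * jumpProfile k 1 x ≤ jumpProfile k N x := by
  unfold jumpProfile
  rw [mul_left_comm]
  gcongr
  refine le_min ?_ ?_
  · exact mul_le_one₀ (Real.rpow_le_one hN0.le hN (by linarith)) (by positivity) (min_le_left _ _)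
  · rw [Real.mul_rpow hN0.le hx.le, one_mul]
    gcongr
    exact min_le_right _ _

/-- Values of `X` near zero have mass comparable to their size, and `X` has a second moment. -/
structure LinearNearZero {Ω : Type*} [MeasurableSpace Ω] (P : Measure Ω) (X : Ω → ℝ)
    (a A : ℝ) : Prop where
  measurable : Measurable X
  pos : ∀ᵐ ω ∂P, 0 < X ω
  lower_pos : 0 < a
  upper_pos : 0 < A
  measure_le : ∀ δ, 0 < δ → P {ω | X ω ≤ δ} ≤ ENNReal.ofReal (A * δ)
  le_measure : ∀ δ, 0 < δ → δ ≤ 1 → ENNReal.ofReal (a * δ) ≤ P {ω | X ω ≤ δ}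
  sq_ne_top : ∫⁻ ω, ENNReal.ofReal (X ω ^ 2) ∂P ≠ ∞

section
variable {Ω : Type*} [MeasurableSpace Ω] {P : Measure Ω} {X : Ω → ℝ} {a A k : ℝ}

lemma LinearNearZero.exists_const_le [IsProbabilityMeasure P]
    (h : LinearNearZero P X a A) (hk : 0 < k) :
    ∃ c, 0 < c ∧ (∀ N, 1 ≤ N → ENNReal.ofReal c ≤ ∫⁻ ω, ENNReal.ofReal (jumpProfile k N (X ω)) ∂P) ∧
      ∀ N, 0 < N → N ≤ 1 → ENNReal.ofReal (c * N ^ (k + 1)) ≤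
        ∫⁻ ω, ENNReal.ofReal (jumpProfile k N (X ω)) ∂P := by
  have hmeas : Measurable fun ω => ENNReal.ofReal (jumpProfile k 1 (X ω)) :=
    ((measurable_jumpProfile k 1).comp h.measurable).ennreal_ofReal
  set c := ∫⁻ ω, ENNReal.ofReal (jumpProfile k 1 (X ω)) ∂P with hc
  have hctop : c ≠ ∞ := by
    refine ne_top_of_le_ne_top h.sq_ne_top (lintegral_mono_ae ?_)
    filter_upwards [h.pos] with ω hω
    exact ENNReal.ofReal_le_ofReal (by simpa using jumpProfile_le_sq (k := k) zero_le_one hω)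
  have hc0 : c ≠ 0 := by
    intro h0
    rw [hc, lintegral_eq_zero_iff hmeas] at h0
    have : ∀ᵐ ω ∂P, False := by
      filter_upwards [h0, h.pos] with ω h1 hω
      have h2 : 0 < jumpProfile k 1 (X ω) := by unfold jumpProfile; positivity
      simp only [Pi.zero_apply, ENNReal.ofReal_eq_zero] at h1
      linarith
    rw [ae_iff] at this
    simp at this
  refine ⟨c.toReal, ENNReal.toReal_pos hc0 hctop, fun N hN => ?_, fun N hN0 hN => ?_⟩
  · rw [ENNReal.ofReal_toReal hctop]
    refine lintegral_mono_ae ?_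
    filter_upwards [h.pos] with ω hω
    exact ENNReal.ofReal_le_ofReal (jumpProfile_mono hk hN hω)
  · rw [mul_comm, ENNReal.ofReal_mul (by positivity), ENNReal.ofReal_toReal hctop, hc,
      ← lintegral_const_mul _ hmeas]
    refine lintegral_mono_ae ?_
    filter_upwards [h.pos] with ω hω
    rw [← ENNReal.ofReal_mul (by positivity)]
    exact ENNReal.ofReal_le_ofReal (rpow_mul_jumpProfile_one_le hk hN0 hN hω)

lemma LinearNearZero.lintegral_le_sq (h : LinearNearZero P X a A) {N : ℝ} (hN : 0 < N) :
    ∫⁻ ω, ENNReal.ofReal (jumpProfile k N (X ω)) ∂P ≤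
      ENNReal.ofReal ((∫⁻ ω, ENNReal.ofReal (X ω ^ 2) ∂P).toReal * N ^ (k + 1)) := by
  rw [mul_comm, ENNReal.ofReal_mul (by positivity), ENNReal.ofReal_toReal h.sq_ne_top,
    ← lintegral_const_mul' _ _ ENNReal.ofReal_ne_top]
  refine lintegral_mono_ae ?_
  filter_upwards [h.pos] with ω hω
  rw [← ENNReal.ofReal_mul (by positivity)]
  exact ENNReal.ofReal_le_ofReal (jumpProfile_le_sq hN.le hω)

lemma LinearNearZero.lintegral_le_of_le_one [IsProbabilityMeasure P]
    (h : LinearNearZero P X a A) (hk : 0 < k)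
    (hk1 : k ≤ 1) (N : ℝ) :
    ∫⁻ ω, ENNReal.ofReal (jumpProfile k N (X ω)) ∂P ≤
      ENNReal.ofReal (1 + (∫⁻ ω, ENNReal.ofReal (X ω ^ 2) ∂P).toReal) := by
  rw [ENNReal.ofReal_add (by positivity) (by positivity), ENNReal.ofReal_toReal h.sq_ne_top]
  calc _ ≤ ∫⁻ ω, (ENNReal.ofReal 1 + ENNReal.ofReal (X ω ^ 2)) ∂P := by
        refine lintegral_mono_ae ?_
        filter_upwards [h.pos] with ω hω
        rw [← ENNReal.ofReal_add (by positivity) (by positivity)]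
        refine ENNReal.ofReal_le_ofReal ((jumpProfile_le_rpow hω.le).trans ?_)
        rcases le_total (X ω) 1 with h1 | h1
        · nlinarith [Real.rpow_le_one hω.le h1 (by linarith : 0 ≤ 1 - k), sq_nonneg (X ω)]
        · have := Real.rpow_le_rpow_of_exponent_le h1 (by linarith : 1 - k ≤ 2)
          rw [Real.rpow_two] at this
          linarith
    _ = _ := by
        rw [lintegral_add_left measurable_const]
        simp

/-- Layer-cake bound of the profile by truncated powers. -/
lemma jumpProfile_le_layer {N x : ℝ} (hk : 1 < k) (hN : 1 ≤ N) (hx : 0 < x) :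
    ENNReal.ofReal (jumpProfile k N x) ≤
      1 + ∫⁻ u in Ioc N⁻¹ 1, ENNReal.ofReal ((k - 1) * u ^ (-k)) *
        (Ici x).indicator 1 u := by
  have hN0 : 0 < N := by linarith
  have hNi : 0 < N⁻¹ := by positivity
  have hNi1 : N⁻¹ ≤ 1 := inv_le_one_of_one_le₀ hN
  have hk0 : 0 < k := by linarith
  rcases le_total 1 x with h1 | h1
  · refine le_add_right ?_
    rw [ENNReal.ofReal_le_one]
    exact (jumpProfile_le_rpow hx.le).trans (Real.rpow_le_one_of_one_le_of_nonpos h1 (by linarith))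
  set y := max x N⁻¹ with hy
  have hy0 : 0 < y := lt_max_of_lt_left hx
  have hy1 : y ≤ 1 := max_le h1 hNi1
  have key : ∫⁻ u in Ioc y 1, ENNReal.ofReal ((k - 1) * u ^ (-k)) =
      ENNReal.ofReal (y ^ (1 - k) - 1) := by
    have h0 : (0 : ℝ) ∉ uIcc y 1 := by
      rw [uIcc_of_le hy1]; exact fun h => absurd h.1 (not_le.mpr hy0)
    rw [← ofReal_integral_eq_lintegral_ofReal]
    · rw [← intervalIntegral.integral_of_le hy1, intervalIntegral.integral_const_mul,
        integral_rpow (Or.inr ⟨by linarith, h0⟩)]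
      congr 1
      have : -k + 1 ≠ 0 := by linarith
      rw [Real.one_rpow, show 1 - k = -k + 1 by ring]
      field_simp
      ring
    · rw [← IntegrableOn, ← intervalIntegrable_iff_integrableOn_Ioc_of_le hy1]
      exact (intervalIntegral.intervalIntegrable_rpow (Or.inr h0)).const_mul _
    · filter_upwards [ae_restrict_mem measurableSet_Ioc] with u hu
      have : 0 < u := hy0.trans hu.1
      have : 0 < k - 1 := by linarith
      simp only [Pi.zero_apply]
      positivity
  have hle : jumpProfile k N x ≤ y ^ (1 - k) := by
    rcases le_total x N⁻¹ with h2 | h2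
    · rw [hy, max_eq_right h2]
      refine (jumpProfile_le_sq hN0.le hx).trans ?_
      rw [Real.inv_rpow hN0.le, ← Real.rpow_neg hN0.le, neg_sub]
      calc N ^ (k + 1) * x ^ 2 ≤ N ^ (k + 1) * N⁻¹ ^ 2 := by gcongr
        _ = N ^ (k + 1) * N ^ (-2 : ℝ) := by
            rw [Real.rpow_neg hN0.le, Real.rpow_two, inv_pow]
        _ = N ^ (k - 1) := by rw [← Real.rpow_add hN0]; ring_nf
    · rw [hy, max_eq_left h2]
      exact jumpProfile_le_rpow hx.le
  calc ENNReal.ofReal (jumpProfile k N x) ≤ ENNReal.ofReal (1 + (y ^ (1 - k) - 1)) :=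
        ENNReal.ofReal_le_ofReal (by linarith)
    _ = 1 + ENNReal.ofReal (y ^ (1 - k) - 1) := by
        rw [ENNReal.ofReal_add zero_le_one, ENNReal.ofReal_one]
        linarith [Real.one_le_rpow_of_pos_of_le_one_of_nonpos hy0 hy1 (by linarith : 1 - k ≤ 0)]
    _ ≤ _ := by
        rw [← key]
        gcongr 1 + ?_
        calc _ ≤ ∫⁻ u in Ioc y 1, ENNReal.ofReal ((k - 1) * u ^ (-k)) *
                (Ici x).indicator 1 u := by
              refine setLIntegral_mono' measurableSet_Ioc fun u hu => ?_
              rw [indicator_of_mem (mem_Ici.mpr ((le_max_left _ _).trans hu.1.le))]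
              simp
          _ ≤ _ := lintegral_mono_set (Ioc_subset_Ioc_left (le_max_right _ _))

lemma LinearNearZero.lintegral_le_layer [IsProbabilityMeasure P]
    (h : LinearNearZero P X a A) (hk : 1 < k) {N : ℝ}
    (hN : 1 ≤ N) :
    ∫⁻ ω, ENNReal.ofReal (jumpProfile k N (X ω)) ∂P ≤
      1 + ∫⁻ u in Ioc N⁻¹ 1, ENNReal.ofReal (A * (k - 1) * u ^ (1 - k)) := by
  have hXm := h.measurable
  have hNi : 0 < N⁻¹ := by positivity
  calc _ ≤ ∫⁻ ω, (1 + ∫⁻ u in Ioc N⁻¹ 1, ENNReal.ofReal ((k - 1) * u ^ (-k)) *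
        (Ici (X ω)).indicator 1 u) ∂P := by
        refine lintegral_mono_ae ?_
        filter_upwards [h.pos] with ω hω
        exact jumpProfile_le_layer hk hN hω
    _ = 1 + ∫⁻ u in Ioc N⁻¹ 1, ∫⁻ ω, ENNReal.ofReal ((k - 1) * u ^ (-k)) *
        (Ici (X ω)).indicator 1 u ∂P := by
        rw [lintegral_add_left measurable_const, lintegral_lintegral_swap]
        · simp
        · refine Measurable.aemeasurable (Measurable.mul (by fun_prop) ?_)
          exact measurable_one.indicator
            (measurableSet_le (hXm.comp measurable_fst) measurable_snd)
    _ ≤ _ := by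
        gcongr 1 + ?_
        refine setLIntegral_mono' measurableSet_Ioc fun u hu => ?_
        have hu0 : 0 < u := hNi.trans hu.1
        have hk1 : 0 < k - 1 := by linarith
        rw [lintegral_const_mul' _ _ ENNReal.ofReal_ne_top]
        have : ∫⁻ ω, (Ici (X ω)).indicator 1 u ∂P = P {ω | X ω ≤ u} := by
          rw [← lintegral_indicator_one (measurableSet_le hXm measurable_const)]
          rfl
        rw [this]
        calc _ ≤ ENNReal.ofReal ((k - 1) * u ^ (-k)) * ENNReal.ofReal (A * u) := by
              gcongr; exact h.measure_le u hu0
          _ = _ := by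
              rw [← ENNReal.ofReal_mul (by positivity)]
              congr 1
              rw [show 1 - k = -k + 1 by ring, Real.rpow_add hu0, Real.rpow_one]
              ring

end

/-- Order of growth, for large `N`, of the mean of `jumpProfile k N`. -/
noncomputable def growthProfile (k N : ℝ) : ℝ :=
  if k < 2 then 1 else if k = 2 then Real.log (2 * N) else N ^ (k - 2)

lemma half_le_growthProfile {k N : ℝ} (hN : 1 ≤ N) : 1 / 2 ≤ growthProfile k N := by
  unfold growthProfile
  split_ifs with h1 h2
  · norm_num
  · have := Real.log_le_log (by norm_num) (by linarith : 2 ≤ 2 * N)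
    linarith [Real.log_two_gt_d9]
  · linarith [Real.one_le_rpow hN (by linarith : 0 ≤ k - 2)]

lemma exists_integral_rpow_le_growthProfile (k : ℝ) :
    ∃ B, 0 < B ∧ ∀ N, 1 ≤ N → ∫ u in N⁻¹..1, u ^ (1 - k) ≤ B * growthProfile k N := by
  have h0 (N : ℝ) (hN : 1 ≤ N) : (0 : ℝ) ∉ uIcc N⁻¹ 1 := by
    rw [uIcc_of_le (inv_le_one_of_one_le₀ hN)]
    exact fun h => absurd h.1 (not_le.mpr (by positivity))
  have hint (N : ℝ) (hN : 1 ≤ N) (hk : k ≠ 2) :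
      ∫ u in N⁻¹..1, u ^ (1 - k) = (1 - N ^ (k - 2)) / (2 - k) := by
    rw [integral_rpow (Or.inr ⟨fun h => hk (by linarith), h0 N hN⟩), Real.one_rpow,
      Real.inv_rpow (by linarith), ← Real.rpow_neg (by linarith),
      show 1 - k + 1 = 2 - k by ring, neg_sub]
  rcases lt_trichotomy k 2 with hk | rfl | hk
  · refine ⟨1 / (2 - k), one_div_pos.mpr (by linarith), fun N hN => ?_⟩
    rw [hint N hN hk.ne, growthProfile, if_pos hk, mul_one]
    have : 0 ≤ N ^ (k - 2) := by positivity
    gcongr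
    linarith
  · refine ⟨1, one_pos, fun N hN => ?_⟩
    have hN0 : 0 < N := by linarith
    have : ∫ u in N⁻¹..1, u ^ ((1 : ℝ) - 2) = ∫ u in N⁻¹..1, u⁻¹ := by
      congr 1; ext u; rw [← Real.rpow_neg_one]; norm_num
    rw [this, integral_inv (h0 N hN), growthProfile, if_neg (lt_irrefl _), if_pos rfl, one_mul]
    refine Real.log_le_log (by positivity) ?_
    rw [one_div, inv_inv]
    linarith
  · have : 0 < k - 2 := by linarith
    refine ⟨1 / (k - 2), by positivity, fun N hN => ?_⟩
    rw [hint N hN hk.ne', growthProfile, if_neg (by linarith), if_neg hk.ne', ← neg_div_neg_eq,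
      neg_sub, neg_sub, one_div_mul_eq_div]
    gcongr
    linarith

section
variable {Ω : Type*} [MeasurableSpace Ω] {P : Measure Ω} {X : Ω → ℝ} {a A k : ℝ}

lemma LinearNearZero.exists_lintegral_le [IsProbabilityMeasure P] (h : LinearNearZero P X a A)
    (hk : 0 < k) : ∃ C, 0 < C ∧ ∀ N, 1 ≤ N →
      ∫⁻ ω, ENNReal.ofReal (jumpProfile k N (X ω)) ∂P ≤
        ENNReal.ofReal (C * growthProfile k N) := by
  rcases le_or_gt k 1 with hk1 | hk1
  · refine ⟨1 + (∫⁻ ω, ENNReal.ofReal (X ω ^ 2) ∂P).toReal, by positivity, fun N hN => ?_⟩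
    rw [growthProfile, if_pos (by linarith), mul_one]
    exact h.lintegral_le_of_le_one hk hk1 N
  obtain ⟨B, hB, hBN⟩ := exists_integral_rpow_le_growthProfile k
  have hA := h.upper_pos
  have hk2 : 0 < k - 1 := by linarith
  refine ⟨2 + A * (k - 1) * B, by positivity, fun N hN => ?_⟩
  have hNi : 0 < N⁻¹ := by positivity
  have hNi1 : N⁻¹ ≤ 1 := inv_le_one_of_one_le₀ hN
  have hG := half_le_growthProfile (k := k) hN
  have h0 : (0 : ℝ) ∉ uIcc N⁻¹ 1 := by
    rw [uIcc_of_le hNi1]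
    exact fun h => absurd h.1 (not_le.mpr hNi)
  refine (h.lintegral_le_layer hk1 hN).trans ?_
  rw [← ofReal_integral_eq_lintegral_ofReal, ← intervalIntegral.integral_of_le hNi1,
    intervalIntegral.integral_const_mul, ← ENNReal.ofReal_one, ← ENNReal.ofReal_add zero_le_one]
  · refine ENNReal.ofReal_le_ofReal ?_
    calc _ ≤ 1 + A * (k - 1) * (B * growthProfile k N) := by gcongr; exact hBN N hN
      _ ≤ _ := by nlinarith
  · have : 0 ≤ ∫ u in N⁻¹..1, u ^ (1 - k) :=
      intervalIntegral.integral_nonneg hNi1 fun u hu => Real.rpow_nonneg (hNi.le.trans hu.1) _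
    positivity
  · rw [← IntegrableOn, ← intervalIntegrable_iff_integrableOn_Ioc_of_le hNi1]
    exact (intervalIntegral.intervalIntegrable_rpow (Or.inr h0)).const_mul _
  · filter_upwards [ae_restrict_mem measurableSet_Ioc] with u hu
    have : 0 < u := hNi.trans hu.1
    simp only [Pi.zero_apply]
    positivity

lemma LinearNearZero.exists_le_measure_Ioc (h : LinearNearZero P X a A) :
    ∃ K, 1 ≤ K ∧ ∀ u, 0 < u → K * u ≤ 1 →
      ENNReal.ofReal u ≤ P {ω | u < X ω ∧ X ω ≤ K * u} := by
  have ha := h.lower_pos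
  have hA := h.upper_pos
  refine ⟨max 1 ((A + 1) / a), le_max_left _ _, fun u hu hKu => ?_⟩
  set K := max 1 ((A + 1) / a)
  have hK : A + 1 ≤ a * K := by
    rw [mul_comm, ← div_le_iff₀ ha]; exact le_max_right _ _
  have hK0 : 0 < K := lt_max_of_lt_left one_pos
  have h1 : P {ω | X ω ≤ K * u} ≤ P {ω | X ω ≤ u} + P {ω | u < X ω ∧ X ω ≤ K * u} := by
    refine (measure_mono fun ω hω => ?_).trans (measure_union_le _ _)
    rcases le_or_gt (X ω) u with h2 | h2
    · exact Or.inl h2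
    · exact Or.inr ⟨h2, hω⟩
  have h2 : ENNReal.ofReal (A * u) + ENNReal.ofReal u ≤
      ENNReal.ofReal (A * u) + P {ω | u < X ω ∧ X ω ≤ K * u} := by
    calc _ = ENNReal.ofReal (A * u + u) := (ENNReal.ofReal_add (by positivity) hu.le).symm
      _ ≤ ENNReal.ofReal (a * (K * u)) := ENNReal.ofReal_le_ofReal (by nlinarith)
      _ ≤ _ := h.le_measure _ (by positivity) hKu
      _ ≤ _ := h1
      _ ≤ _ := by gcongr; exact h.measure_le u hu
  exact (ENNReal.add_le_add_iff_left ENNReal.ofReal_ne_top).mp h2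

lemma LinearNearZero.exists_rpow_le (h : LinearNearZero P X a A) (hk : 0 < k) :
    ∃ c, 0 < c ∧ ∀ N, 1 ≤ N → ENNReal.ofReal (c * N ^ (k - 2)) ≤
      ∫⁻ ω, ENNReal.ofReal (jumpProfile k N (X ω)) ∂P := by
  obtain ⟨K, hK, hKu⟩ := h.exists_le_measure_Ioc
  have hK0 : 0 < K := by linarith
  refine ⟨K⁻¹ ^ 3, by positivity, fun N hN => ?_⟩
  have hN0 : 0 < N := by linarith
  set u := (K * N)⁻¹ with hu
  have hKu1 : K * u = N⁻¹ := by rw [hu]; field_simp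
  set S := {ω | u < X ω ∧ X ω ≤ K * u} with hS
  have hSm : MeasurableSet S := (measurableSet_lt measurable_const h.measurable).inter
    (measurableSet_le h.measurable measurable_const)
  have h1 := hKu u (by positivity) (by rw [hKu1]; exact inv_le_one_of_one_le₀ hN)
  calc ENNReal.ofReal (K⁻¹ ^ 3 * N ^ (k - 2))
      = ENNReal.ofReal (N ^ (k + 1) * u ^ 2) * ENNReal.ofReal u := by
        rw [← ENNReal.ofReal_mul (by positivity)]
        congr 1
        rw [show k + 1 = (k - 2) + (3 : ℕ) by push_cast; ring, Real.rpow_add_natCast hN0.ne', hu]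
        field_simp
    _ ≤ ENNReal.ofReal (N ^ (k + 1) * u ^ 2) * P S := by gcongr
    _ = ∫⁻ ω in S, ENNReal.ofReal (N ^ (k + 1) * u ^ 2) ∂P := by rw [setLIntegral_const]
    _ ≤ ∫⁻ ω in S, ENNReal.ofReal (jumpProfile k N (X ω)) ∂P := by
        refine setLIntegral_mono' hSm fun ω hω => ENNReal.ofReal_le_ofReal ?_
        have hu0 : 0 < u := by positivity
        have hX : 0 < X ω := hu0.trans hω.1
        rw [jumpProfile_eq_sq hk hN0.le hX]
        · gcongr; exact hω.1.le
        · calc N * X ω ≤ N * (K * u) := by gcongr; exact hω.2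
            _ = 1 := by rw [hKu1]; field_simp
    _ ≤ _ := setLIntegral_le_lintegral _ _

lemma lintegral_layer_le_jumpProfile_two {K N x : ℝ} (hK : 1 ≤ K) (hN : 1 ≤ N) (hx : 0 < x) :
    ∫⁻ u in Ioc N⁻¹ K⁻¹, ENNReal.ofReal (u ^ (-2 : ℝ)) *
      (Ico (x / K) x).indicator 1 u ≤ ENNReal.ofReal (K ^ 2 * jumpProfile 2 N x) := by
  have hK0 : 0 < K := by linarith
  have hN0 : 0 < N := by linarith
  rcases lt_or_ge (N * x) 1 with h | h
  · rw [setLIntegral_congr_fun (g := fun _ => 0) measurableSet_Ioc]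
    · simp
    · intro u hu
      have : u ∉ Ico (x / K) x := by
        intro hu'
        have h2 := hu.1.trans hu'.2
        rw [inv_lt_iff_one_lt_mul₀' hN0] at h2
        linarith
      simp [this]
  · rw [jumpProfile_eq_rpow (by norm_num) h]
    calc _ ≤ ∫⁻ u, (Ico (x / K) x).indicator (fun _ => ENNReal.ofReal ((x / K) ^ (-2 : ℝ))) u := by
          refine (setLIntegral_le_lintegral _ _).trans (lintegral_mono fun u => ?_)
          by_cases hu : u ∈ Ico (x / K) x
          · simp only [indicator_of_mem hu, Pi.one_apply, mul_one]
            exact ENNReal.ofReal_le_ofReal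
              (Real.rpow_le_rpow_of_nonpos (by positivity) hu.1 (by norm_num))
          · simp [hu]
      _ ≤ ENNReal.ofReal ((x / K) ^ (-2 : ℝ)) * ENNReal.ofReal x := by
          rw [lintegral_indicator_const measurableSet_Ico, Real.volume_Ico]
          gcongr
          have : 0 < x / K := by positivity
          linarith
      _ = _ := by
          rw [← ENNReal.ofReal_mul (by positivity)]
          congr 1
          rw [show (1 : ℝ) - 2 = -1 by norm_num, Real.rpow_neg_one, Real.rpow_neg (by positivity),
            Real.rpow_two]
          field_simp

lemma LinearNearZero.exists_log_le [IsProbabilityMeasure P] (h : LinearNearZero P X a A) :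
    ∃ c, 0 < c ∧ ∀ N, 1 ≤ N → ENNReal.ofReal (c * Real.log (2 * N)) ≤
      ∫⁻ ω, ENNReal.ofReal (jumpProfile 2 N (X ω)) ∂P := by
  have hXm := h.measurable
  obtain ⟨K₀, hK₀, hKu₀⟩ := h.exists_le_measure_Ioc
  obtain ⟨c, hc, hcN, -⟩ := h.exists_const_le (k := 2) (by norm_num)
  obtain ⟨K, hK, hK2, hKu⟩ : ∃ K : ℝ, 1 ≤ K ∧ 2 ≤ K ∧ ∀ u, 0 < u → K * u ≤ 1 →
      ENNReal.ofReal u ≤ P {ω | u < X ω ∧ X ω ≤ K * u} := by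
    refine ⟨2 * K₀, by linarith, by linarith, fun u hu hu1 => ?_⟩
    refine (hKu₀ u hu (by nlinarith)).trans (measure_mono fun ω hω => ⟨hω.1, hω.2.trans ?_⟩)
    nlinarith
  have hK0 : 0 < K := by linarith
  have hlogK : 0 < Real.log (2 * K ^ 2) := Real.log_pos (by nlinarith)
  refine ⟨min (c / Real.log (2 * K ^ 2)) (1 / (4 * K ^ 2)), by positivity, fun N hN => ?_⟩
  have hN0 : 0 < N := by linarith
  have hlog : 0 ≤ Real.log (2 * N) := Real.log_nonneg (by linarith)
  rcases le_total N (K ^ 2) with hNK | hNK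
  · refine (ENNReal.ofReal_le_ofReal ?_).trans (hcN N hN)
    calc _ ≤ c / Real.log (2 * K ^ 2) * Real.log (2 * K ^ 2) := by
          gcongr
          exact min_le_left _ _
      _ = c := by field_simp
  have hNK1 : K ≤ N := by nlinarith
  have hle : N⁻¹ ≤ K⁻¹ := inv_anti₀ hK0 hNK1
  have hNi : 0 < N⁻¹ := by positivity
  have h0 : (0 : ℝ) ∉ uIcc N⁻¹ K⁻¹ := by
    rw [uIcc_of_le hle]
    exact fun h => absurd h.1 (not_le.mpr hNi)
  have hint : ∫⁻ u in Ioc N⁻¹ K⁻¹, ENNReal.ofReal u⁻¹ = ENNReal.ofReal (Real.log (N / K)) := by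
    rw [← ofReal_integral_eq_lintegral_ofReal, ← intervalIntegral.integral_of_le hle,
      integral_inv h0]
    · congr 2
      field_simp
    · rw [← IntegrableOn, ← intervalIntegrable_iff_integrableOn_Ioc_of_le hle]
      exact intervalIntegral.intervalIntegrable_inv (fun u hu h' => h0 (h' ▸ hu)) continuousOn_id
    · filter_upwards [ae_restrict_mem measurableSet_Ioc] with u hu
      have : 0 < u := hNi.trans hu.1
      simp only [Pi.zero_apply]
      positivity
  have hmain : ENNReal.ofReal (Real.log (N / K)) ≤ ENNReal.ofReal (K ^ 2) *
      ∫⁻ ω, ENNReal.ofReal (jumpProfile 2 N (X ω)) ∂P := by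
    rw [← lintegral_const_mul' _ _ ENNReal.ofReal_ne_top, ← hint]
    calc _ ≤ ∫⁻ u in Ioc N⁻¹ K⁻¹, ∫⁻ ω, ENNReal.ofReal (u ^ (-2 : ℝ)) *
          (Ico (X ω / K) (X ω)).indicator 1 u ∂P := by
          refine setLIntegral_mono' measurableSet_Ioc fun u hu => ?_
          have hu0 : 0 < u := hNi.trans hu.1
          rw [lintegral_const_mul' _ _ ENNReal.ofReal_ne_top]
          have : ∫⁻ ω, (Ico (X ω / K) (X ω)).indicator 1 u ∂P
              = P {ω | u < X ω ∧ X ω ≤ K * u} := by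
            have hm : MeasurableSet {ω | u < X ω ∧ X ω ≤ K * u} :=
              (measurableSet_lt measurable_const hXm).inter
                (measurableSet_le hXm measurable_const)
            rw [← lintegral_indicator_one hm]
            congr 1 with ω
            simp only [indicator, mem_Ico, mem_ofPred_eq, Pi.one_apply,
              div_le_iff₀' hK0, and_comm]
          rw [this]
          calc _ = ENNReal.ofReal (u ^ (-2 : ℝ)) * ENNReal.ofReal u := by
                rw [← ENNReal.ofReal_mul (by positivity)]
                congr 1
                rw [Real.rpow_neg hu0.le, Real.rpow_two]
                field_simp
            _ ≤ _ := by
                gcongr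
                refine hKu u hu0 ?_
                calc K * u ≤ K * K⁻¹ := by gcongr; exact hu.2
                  _ = 1 := by field_simp
      _ = ∫⁻ ω, (∫⁻ u in Ioc N⁻¹ K⁻¹, ENNReal.ofReal (u ^ (-2 : ℝ)) *
          (Ico (X ω / K) (X ω)).indicator 1 u) ∂P := by
          rw [lintegral_lintegral_swap]
          refine Measurable.aemeasurable (Measurable.mul (by fun_prop) ?_)
          exact measurable_one.indicator ((measurableSet_le
            ((hXm.comp measurable_snd).div_const K) measurable_fst).inter
            (measurableSet_lt measurable_fst (hXm.comp measurable_snd)))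
      _ ≤ _ := by
          refine lintegral_mono_ae ?_
          filter_upwards [h.pos] with ω hω
          rw [← ENNReal.ofReal_mul (by positivity)]
          exact lintegral_layer_le_jumpProfile_two hK hN hω
  have hlogle : Real.log (2 * N) ≤ 4 * Real.log (N / K) := by
    rw [← Real.log_rpow (by positivity)]
    refine Real.log_le_log (by positivity) ?_
    have h4 : (N / K) ^ (4 : ℝ) = (N / K) ^ 4 := by exact_mod_cast Real.rpow_natCast (N / K) 4
    rw [h4, div_pow, le_div_iff₀ (by positivity)]
    have h5 : K ^ 4 ≤ N ^ 2 := by nlinarith [sq_nonneg K]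
    have h6 : 2 ≤ N := by linarith
    calc 2 * N * K ^ 4 ≤ N * N * N ^ 2 := by gcongr
      _ = N ^ 4 := by ring
  calc _ ≤ ENNReal.ofReal ((K ^ 2)⁻¹ * Real.log (N / K)) := by
        refine ENNReal.ofReal_le_ofReal ?_
        calc _ ≤ 1 / (4 * K ^ 2) * (4 * Real.log (N / K)) := by
              gcongr
              exact min_le_right _ _
          _ = _ := by field_simp
    _ ≤ ENNReal.ofReal (K ^ 2)⁻¹ * (ENNReal.ofReal (K ^ 2) *
          ∫⁻ ω, ENNReal.ofReal (jumpProfile 2 N (X ω)) ∂P) := by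
        rw [ENNReal.ofReal_mul (by positivity)]
        gcongr
    _ = _ := by
        rw [← mul_assoc, ← ENNReal.ofReal_mul (by positivity), inv_mul_cancel₀ (by positivity)]
        simp

lemma LinearNearZero.exists_growthProfile_le [IsProbabilityMeasure P]
    (h : LinearNearZero P X a A) (hk : 0 < k) :
    ∃ c, 0 < c ∧ ∀ N, 1 ≤ N → ENNReal.ofReal (c * growthProfile k N) ≤
      ∫⁻ ω, ENNReal.ofReal (jumpProfile k N (X ω)) ∂P := by
  unfold growthProfile
  split_ifs with h1 h2
  · obtain ⟨c, hc, hcN, -⟩ := h.exists_const_le hk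
    exact ⟨c, hc, by simpa using hcN⟩
  · subst h2
    exact h.exists_log_le
  · exact h.exists_rpow_le hk

/-- Two-sided estimate for the mean of the jump profile. -/
lemma LinearNearZero.exists_two_sided [IsProbabilityMeasure P]
    (h : LinearNearZero P X a A) (hk : 0 < k) :
    ∃ C, 1 ≤ C ∧ ∀ N, 0 < N →
      (1 ≤ N →
        ENNReal.ofReal (C⁻¹ * growthProfile k N) ≤
          ∫⁻ ω, ENNReal.ofReal (jumpProfile k N (X ω)) ∂P ∧
        ∫⁻ ω, ENNReal.ofReal (jumpProfile k N (X ω)) ∂P ≤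
          ENNReal.ofReal (C * growthProfile k N)) ∧
      (N ≤ 1 →
        ENNReal.ofReal (C⁻¹ * N ^ (k + 1)) ≤ ∫⁻ ω, ENNReal.ofReal (jumpProfile k N (X ω)) ∂P ∧
        ∫⁻ ω, ENNReal.ofReal (jumpProfile k N (X ω)) ∂P ≤ ENNReal.ofReal (C * N ^ (k + 1))) := by
  obtain ⟨C₁, hC₁, h1⟩ := h.exists_lintegral_le hk
  obtain ⟨c₁, hc₁, h2⟩ := h.exists_growthProfile_le hk
  obtain ⟨c₂, hc₂, -, h3⟩ := h.exists_const_le hk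
  set C₂ := (∫⁻ ω, ENNReal.ofReal (X ω ^ 2) ∂P).toReal
  have hC₂ : 0 ≤ C₂ := by positivity
  refine ⟨1 + C₁ + C₂ + c₁⁻¹ + c₂⁻¹, ?_, fun N hN => ⟨fun hN1 => ⟨?_, ?_⟩, fun hN1 => ⟨?_, ?_⟩⟩⟩
  · have : 0 < c₁⁻¹ := by positivity
    have : 0 < c₂⁻¹ := by positivity
    linarith
  · have hG := half_le_growthProfile (k := k) hN1
    refine (ENNReal.ofReal_le_ofReal ?_).trans (h2 N hN1)
    gcongr
    rw [inv_le_comm₀ (by positivity) hc₁]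
    linarith [inv_pos.mpr hc₂]
  · have hG := half_le_growthProfile (k := k) hN1
    refine (h1 N hN1).trans (ENNReal.ofReal_le_ofReal ?_)
    gcongr
    linarith [inv_pos.mpr hc₂, inv_pos.mpr hc₁]
  · refine (ENNReal.ofReal_le_ofReal ?_).trans (h3 N hN hN1)
    gcongr
    rw [inv_le_comm₀ (by positivity) hc₂]
    linarith [inv_pos.mpr hc₁]
  · refine (h.lintegral_le_sq hN).trans (ENNReal.ofReal_le_ofReal ?_)
    gcongr
    linarith [inv_pos.mpr hc₂, inv_pos.mpr hc₁]

end

/-- A finite measure on the half-line is determined by its Laplace transform. -/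
lemma MeasureTheory.Measure.ext_of_laplace_eq {μ ν : Measure ℝ} [IsFiniteMeasure μ]
    [IsFiniteMeasure ν] (hμ : ∀ᵐ s ∂μ, 0 ≤ s) (hν : ∀ᵐ s ∂ν, 0 ≤ s)
    (h : ∀ l, 0 < l → ∫ s, Real.exp (-l * s) ∂μ = ∫ s, Real.exp (-l * s) ∂ν) : μ = ν := by
  open ProbabilityTheory in
  have hsub {ρ : Measure ℝ} [IsFiniteMeasure ρ] (hρ : ∀ᵐ s ∂ρ, 0 ≤ s) :
      Iio 0 ⊆ interior (integrableExpSet id ρ) := by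
    refine interior_maximal (fun t ht => ?_) isOpen_Iio
    refine Integrable.of_bound (C := 1) (by fun_prop) ?_
    filter_upwards [hρ] with s hs
    rw [Real.norm_of_nonneg (Real.exp_pos _).le, Real.exp_le_one_iff]
    exact mul_nonpos_of_nonpos_of_nonneg (mem_Iio.mp ht).le hs
  have hset : IsPreconnected {z : ℂ | z.re < 0} := (convex_halfSpace_re_lt 0).isPreconnected
  have heq : EqOn (complexMGF id μ) (complexMGF id ν) {z : ℂ | z.re < 0} := by
    refine AnalyticOnNhd.eqOn_of_preconnected_of_frequently_eq
      (analyticOnNhd_complexMGF.mono fun z hz => hsub hμ hz)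
      (analyticOnNhd_complexMGF.mono fun z hz => hsub hν hz) hset
      (z₀ := ((-1 : ℝ) : ℂ)) (by simp) ?_
    have h_real : ∃ᶠ x : ℝ in 𝓝[≠] (-1), complexMGF id μ x = complexMGF id ν x := by
      refine Eventually.frequently (eventually_nhdsWithin_of_eventually_nhds ?_)
      filter_upwards [Iio_mem_nhds (by norm_num : (-1 : ℝ) < 0)] with x hx
      rw [complexMGF_ofReal, complexMGF_ofReal]
      simpa [mgf] using h (-x) (by simpa using hx)
    rw [frequently_iff_seq_forall] at h_real ⊢
    obtain ⟨xs, hx_tendsto, hx_eq⟩ := h_real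
    refine ⟨fun n => xs n, ?_, hx_eq⟩
    rw [tendsto_nhdsWithin_iff] at hx_tendsto ⊢
    constructor
    · exact (Complex.continuous_ofReal.tendsto _).comp hx_tendsto.1
    · filter_upwards [hx_tendsto.2] with n hn
      simpa only [mem_compl_iff, mem_singleton_iff, Complex.ofReal_inj] using hn
  have hlim {ρ : Measure ℝ} [IsFiniteMeasure ρ] (hρ : ∀ᵐ s ∂ρ, 0 ≤ s) (t : ℝ) :
      Tendsto (fun n : ℕ => complexMGF id ρ (-(1 / ((n : ℝ) + 1) : ℝ) + t * Complex.I)) atTop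
        (𝓝 (complexMGF id ρ (t * Complex.I))) := by
    refine tendsto_integral_of_dominated_convergence (fun _ => 1)
      (fun n => by fun_prop) (integrable_const _) (fun n => ?_) ?_
    · filter_upwards [hρ] with s hs
      rw [Complex.norm_exp]
      simp only [id_eq, Complex.mul_re, Complex.add_re, Complex.neg_re, Complex.ofReal_re,
        Complex.ofReal_im, Complex.I_re, Complex.I_im, mul_zero, mul_one, sub_zero, add_zero,
        Real.exp_le_one_iff, sub_self]
      have : 0 ≤ 1 / ((n : ℝ) + 1) := by positivity
      nlinarith
    · refine ae_of_all _ fun s => ?_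
      have h0 : Tendsto (fun n : ℕ => ((1 / ((n : ℝ) + 1) : ℝ) : ℂ)) atTop (𝓝 ((0 : ℝ) : ℂ)) :=
        (Complex.continuous_ofReal.tendsto 0).comp tendsto_one_div_add_atTop_nhds_zero_nat
      have := (((h0.neg).add_const (t * Complex.I)).mul_const ((id s : ℝ) : ℂ)).cexp
      simpa using this
  refine Measure.ext_of_charFun (funext fun t => ?_)
  rw [← complexMGF_id_mul_I, ← complexMGF_id_mul_I]
  refine tendsto_nhds_unique (hlim hμ t) ((hlim hν t).congr fun n => (heq ?_).symm)
  simp only [mem_ofPred_eq, Complex.add_re, Complex.neg_re, Complex.ofReal_re, Complex.mul_re,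
    Complex.I_re, Complex.I_im, Complex.ofReal_im, mul_zero, mul_one, add_zero, sub_self]
  have : 0 < 1 / ((n : ℝ) + 1) := by positivity
  linarith

/-- If the density of a dilated half-line measure is continuous, it is the dilated density. -/
lemma density_map_mul_eq {f g : ℝ → ℝ} (hf0 : ∀ t, 0 ≤ f t) (hg0 : ∀ t, 0 ≤ g t)
    (hf : Continuous f) (hg : Continuous g) {μ ν : Measure ℝ} {c : ℝ} (hc : 0 < c)
    (hμ : ∀ A, MeasurableSet A → μ A = ∫⁻ t in A ∩ Ici 0, ENNReal.ofReal (f t))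
    (hν : ∀ A, MeasurableSet A → ν A = ∫⁻ t in A ∩ Ici 0, ENNReal.ofReal (g t))
    (h : ν = μ.map (c * ·)) {s : ℝ} (hs : 0 < s) : c * g (c * s) = f s := by
  have hcm : Measurable fun s : ℝ => c * s := measurable_const_mul c
  have hinj : Function.Injective fun s : ℝ => c * s := mul_right_injective₀ hc.ne'
  have hae : (fun s => ENNReal.ofReal (c * g (c * s))) =ᵐ[volume.restrict (Ioi 0)]
      fun s => ENNReal.ofReal (f s) := by
    refine ae_eq_of_forall_setLIntegral_eq_of_sigmaFinite (by fun_prop) (by fun_prop)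
      fun B hB _ => ?_
    rw [Measure.restrict_restrict hB]
    set D := B ∩ Ioi (0 : ℝ) with hD
    have hDm : MeasurableSet D := hB.inter measurableSet_Ioi
    have hDi : MeasurableSet ((c * ·) '' D) :=
      (Homeomorph.mulLeft₀ c hc.ne').measurableEmbedding.measurableSet_image.mpr hDm
    have h1 : D ∩ Ici 0 = D := inter_eq_left.mpr fun x hx => mem_Ici.mpr (le_of_lt hx.2)
    have h2 : ((c * ·) '' D) ∩ Ici 0 = (c * ·) '' D := by
      refine inter_eq_left.mpr ?_
      rintro _ ⟨x, hx, rfl⟩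
      exact mul_nonneg hc.le (le_of_lt hx.2)
    have h3 : ν ((c * ·) '' D) = μ D := by
      rw [h, Measure.map_apply hcm hDi, preimage_image_eq _ hinj]
    rw [hμ D hDm, hν _ hDi, h1, h2, lintegral_image_eq_lintegral_abs_deriv_mul (f' := fun _ => c)
      hDm (fun x _ => by simpa using ((hasDerivAt_id x).const_mul c).hasDerivWithinAt)
      hinj.injOn] at h3
    rw [← h3]
    refine lintegral_congr fun x => ?_
    rw [abs_of_pos hc, ENNReal.ofReal_mul hc.le]
  have hreal : (fun s => c * g (c * s)) =ᵐ[volume.restrict (Ioi 0)] f := by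
    filter_upwards [hae] with x hx
    rwa [ENNReal.ofReal_eq_ofReal_iff (mul_nonneg hc.le (hg0 _)) (hf0 _)] at hx
  exact Measure.eqOn_open_of_ae_eq hreal isOpen_Ioi (by fun_prop) (by fun_prop) (mem_Ioi.mpr hs)

/-- Self-similarity of the densities of a stable subordinator. -/
lemma stable_density_scaling {β : ℝ} {μr : ℝ → Measure ℝ}
    (hprob : ∀ r, 0 < r → IsProbabilityMeasure (μr r))
    (hlap : ∀ r, 0 < r → ∀ l, 0 < l →
      ∫ s, Real.exp (-l * s) ∂(μr r) = Real.exp (-r * l ^ β))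
    {pbar : ℝ → ℝ → ℝ} (hnn : ∀ r t, 0 ≤ pbar r t) (hcont : ∀ r, 0 < r → Continuous (pbar r))
    (hdens : ∀ r, 0 < r → ∀ A, MeasurableSet A →
      μr r A = ∫⁻ t in A ∩ Ici 0, ENNReal.ofReal (pbar r t))
    {t s : ℝ} (ht : 0 < t) (hs : 0 < s) :
    pbar ((t / s) ^ β) t = s / t * pbar 1 s := by
  have hnonneg (r : ℝ) (hr : 0 < r) : ∀ᵐ x ∂(μr r), 0 ≤ x := by
    have : {x : ℝ | ¬ 0 ≤ x} = Iio 0 := by ext; simp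
    rw [ae_iff, this, hdens r hr _ measurableSet_Iio, Iio_inter_Ici, Ico_self]
    simp
  have hc : 0 < t / s := by positivity
  have hr : 0 < (t / s) ^ β := by positivity
  have := hprob _ hr
  have := hprob 1 one_pos
  have hm : Measurable fun x : ℝ => t / s * x := measurable_const_mul _
  have := Measure.isFiniteMeasure_map (μr 1) (t / s * ·)
  have hmap : μr ((t / s) ^ β) = (μr 1).map (t / s * ·) := by
    refine Measure.ext_of_laplace_eq (hnonneg _ hr) ?_ fun l hl => ?_
    · rw [ae_map_iff hm.aemeasurable measurableSet_Ici]
      filter_upwards [hnonneg 1 one_pos] with x hx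
      positivity
    · rw [integral_map hm.aemeasurable (by fun_prop), hlap _ hr l hl]
      have := hlap 1 one_pos (l * (t / s)) (by positivity)
      simp only [neg_mul, one_mul, mul_assoc] at this ⊢
      rw [this, Real.mul_rpow hl.le hc.le, mul_comm]
  have := density_map_mul_eq (hnn 1) (hnn _) (hcont 1 one_pos) (hcont _ hr) hc
    (hdens 1 one_pos) (hdens _ hr) hmap hs
  rw [div_mul_cancel₀ _ hs.ne'] at this
  rw [← this]
  field_simp

lemma half_le_one_sub_exp_neg {x : ℝ} (hx : 0 ≤ x) (hx1 : x ≤ 1) : x / 2 ≤ 1 - Real.exp (-x) := by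
  have h1 := Real.add_one_le_exp x
  have h2 : Real.exp (-x) ≤ (1 + x)⁻¹ := by
    rw [Real.exp_neg]
    exact inv_anti₀ (by positivity) (by linarith)
  have h3 : (1 + x)⁻¹ ≤ 1 - x / 2 := by
    rw [inv_le_iff_one_le_mul₀ (by positivity)]
    nlinarith
  linarith

lemma half_le_one_sub_exp_neg_of_one_le {x : ℝ} (hx : 1 ≤ x) : 1 / 2 ≤ 1 - Real.exp (-x) := by
  have h1 := half_le_one_sub_exp_neg zero_le_one le_rfl
  have h2 : Real.exp (-x) ≤ Real.exp (-1) := Real.exp_le_exp.mpr (by linarith)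
  linarith

section
variable {β : ℝ} {ν : Measure ℝ} [IsProbabilityMeasure ν]

lemma integrable_exp_neg_mul (hpos : ∀ᵐ s ∂ν, 0 < s) {l : ℝ} (hl : 0 < l) :
    Integrable (fun s => Real.exp (-l * s)) ν := by
  refine Integrable.of_bound (C := 1) (by fun_prop) ?_
  filter_upwards [hpos] with s hs
  rw [Real.norm_of_nonneg (Real.exp_pos _).le, Real.exp_le_one_iff]
  nlinarith

lemma stable_tail_le (hpos : ∀ᵐ s ∂ν, 0 < s)
    (hlap : ∀ l, 0 < l → ∫ s, Real.exp (-l * s) ∂ν = Real.exp (-l ^ β)) {l : ℝ} (hl : 0 < l) :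
    ν.real {s | 1 ≤ l * s} ≤ 2 * l ^ β := by
  have hm : MeasurableSet {s | 1 ≤ l * s} := measurableSet_le (by fun_prop) (by fun_prop)
  have hint := (integrable_const (μ := ν) (1 : ℝ)).sub (integrable_exp_neg_mul hpos hl)
  calc ν.real {s | 1 ≤ l * s} = ∫ s, {s | 1 ≤ l * s}.indicator 1 s ∂ν :=
        (integral_indicator_one hm).symm
    _ ≤ ∫ s, 2 * (1 - Real.exp (-l * s)) ∂ν := by
        refine integral_mono_ae ((integrable_const (1 : ℝ)).indicator hm) (hint.const_mul 2) ?_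
        filter_upwards [hpos] with s hs
        by_cases h : 1 ≤ l * s
        · have := half_le_one_sub_exp_neg_of_one_le h
          rw [indicator_of_mem (by exact h), neg_mul]
          simp only [Pi.one_apply]
          linarith
        · rw [indicator_of_notMem (by exact h)]
          have : Real.exp (-l * s) ≤ 1 := Real.exp_le_one_iff.mpr (by nlinarith)
          linarith
    _ = 2 * (1 - Real.exp (-l ^ β)) := by
        rw [integral_const_mul, integral_sub (integrable_const _) (integrable_exp_neg_mul hpos hl),
          hlap l hl]
        simp
    _ ≤ _ := by linarith [Real.add_one_le_exp (-l ^ β)]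

lemma exists_le_stable_tail (hβ : 0 < β) (hβ1 : β < 1) (hpos : ∀ᵐ s ∂ν, 0 < s)
    (hlap : ∀ l, 0 < l → ∫ s, Real.exp (-l * s) ∂ν = Real.exp (-l ^ β)) :
    ∃ c, 0 < c ∧ ∀ l, 0 < l → l ≤ 1 → c * l ^ β ≤ ν.real {s | 1 ≤ l * s} := by
  obtain ⟨ε, hε, hε1, hεβ⟩ : ∃ ε : ℝ, 0 < ε ∧ ε ≤ 1 ∧ 8 * ε = ε ^ β := by
    have hb : 0 < 1 - β := by linarith
    have h8 : (0 : ℝ) < (1 / 8) ^ (1 / (1 - β)) := by positivity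
    refine ⟨(1 / 8) ^ (1 / (1 - β)), h8, Real.rpow_le_one (by norm_num) (by norm_num)
      (by positivity), ?_⟩
    have h1 : ((1 / 8 : ℝ) ^ (1 / (1 - β))) ^ (1 - β) = 1 / 8 := by
      rw [← Real.rpow_mul (by norm_num), one_div_mul_cancel hb.ne', Real.rpow_one]
    rw [Real.rpow_sub h8, Real.rpow_one, div_eq_iff (by positivity)] at h1
    linarith
  refine ⟨ε ^ β / 4, by positivity, fun l hl hl1 => ?_⟩
  have hm : MeasurableSet {s | 1 ≤ l * s} := measurableSet_le (by fun_prop) (by fun_prop)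
  have hi1 := (integrable_const (μ := ν) (1 : ℝ)).sub
    (integrable_exp_neg_mul hpos (by positivity : 0 < ε * l))
  have hi2 : Integrable (fun s => 2 * ε * (1 - Real.exp (-l * s))) ν :=
    ((integrable_const (1 : ℝ)).sub (integrable_exp_neg_mul hpos hl)).const_mul (2 * ε)
  have hi3 : Integrable ({s | 1 ≤ l * s}.indicator (1 : ℝ → ℝ)) ν :=
    (integrable_const (1 : ℝ)).indicator hm
  have key : 1 - Real.exp (-(ε * l) ^ β) ≤
      ν.real {s | 1 ≤ l * s} + 2 * ε * (1 - Real.exp (-l ^ β)) := by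
    calc _ = ∫ s, (1 - Real.exp (-(ε * l) * s)) ∂ν := by
          rw [integral_sub (integrable_const _) (integrable_exp_neg_mul hpos (by positivity)),
            hlap _ (by positivity)]
          simp
      _ ≤ ∫ s, ({s | 1 ≤ l * s}.indicator 1 s + 2 * ε * (1 - Real.exp (-l * s))) ∂ν := by
          refine integral_mono_ae hi1 (hi3.add hi2) ?_
          filter_upwards [hpos] with s hs
          have hls : 0 < l * s := by positivity
          by_cases h : 1 ≤ l * s
          · rw [indicator_of_mem (by exact h)]
            have h1 : Real.exp (-l * s) ≤ 1 := Real.exp_le_one_iff.mpr (by nlinarith)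
            have h2 := Real.exp_pos (-(ε * l) * s)
            have h3 : 0 ≤ 2 * ε * (1 - Real.exp (-l * s)) := by
              refine mul_nonneg (by positivity) (by linarith)
            simp only [Pi.one_apply]
            linarith
          · rw [indicator_of_notMem (by exact h)]
            have h1 := half_le_one_sub_exp_neg hls.le (not_le.mp h).le
            have h2 := Real.add_one_le_exp (-(ε * l) * s)
            rw [← neg_mul] at h1
            nlinarith
      _ = _ := by
          rw [integral_add hi3 hi2, integral_indicator_one hm, integral_const_mul,
            integral_sub (integrable_const _) (integrable_exp_neg_mul hpos hl), hlap l hl]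
          simp
  have h1 := half_le_one_sub_exp_neg (x := (ε * l) ^ β) (by positivity)
    (Real.rpow_le_one (by positivity) (mul_le_one₀ hε1 hl.le hl1) hβ.le)
  rw [Real.mul_rpow hε.le hl.le] at h1 key
  have h2 : 2 * ε * (1 - Real.exp (-l ^ β)) ≤ 2 * ε * l ^ β := by
    gcongr
    linarith [Real.add_one_le_exp (-l ^ β)]
  have h3 : 2 * ε * l ^ β = ε ^ β / 4 * l ^ β := by rw [← hεβ]; ring
  linarith

lemma stable_negative_moment_ne_top (hβ : 0 < β) (hpos : ∀ᵐ s ∂ν, 0 < s)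
    (hlap : ∀ l, 0 < l → ∫ s, Real.exp (-l * s) ∂ν = Real.exp (-l ^ β)) :
    ∫⁻ s, ENNReal.ofReal ((s ^ (-β)) ^ 2) ∂ν ≠ ∞ := by
  have hG : 0 < Real.Gamma (2 * β) := Real.Gamma_pos_of_pos (by positivity)
  have hrep : ∀ s, 0 < s → ENNReal.ofReal ((s ^ (-β)) ^ 2) =
      ENNReal.ofReal (Real.Gamma (2 * β))⁻¹ *
        ∫⁻ l in Ioi 0, ENNReal.ofReal (l ^ (2 * β - 1) * Real.exp (-(s * l))) := by
    intro s hs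
    have hval := Real.integral_rpow_mul_exp_neg_mul_Ioi (by positivity : 0 < 2 * β) hs
    have hint : IntegrableOn (fun l : ℝ => l ^ (2 * β - 1) * Real.exp (-(s * l))) (Ioi 0) := by
      refine Integrable.of_integral_ne_zero ?_
      rw [hval]
      positivity
    rw [← ofReal_integral_eq_lintegral_ofReal hint, hval, ← ENNReal.ofReal_mul (by positivity)]
    · congr 1
      rw [← Real.rpow_natCast, ← Real.rpow_mul hs.le, one_div, Real.inv_rpow hs.le,
        ← Real.rpow_neg hs.le]
      field_simp
      push_cast
      ring_nf
    · filter_upwards [ae_restrict_mem measurableSet_Ioi] with l hl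
      have : 0 < l := hl
      simp only [Pi.zero_apply]
      positivity
  have hinner : ∀ l : ℝ, 0 < l →
      ∫⁻ s, ENNReal.ofReal (l ^ (2 * β - 1) * Real.exp (-(s * l))) ∂ν =
        ENNReal.ofReal (l ^ (2 * β - 1) * Real.exp (-l ^ β)) := by
    intro l hl
    rw [← hlap l hl, ← integral_const_mul, ofReal_integral_eq_lintegral_ofReal
      ((integrable_exp_neg_mul hpos hl).const_mul _) (ae_of_all _ fun s => by
        simp only [Pi.zero_apply]; positivity)]
    simp only [neg_mul, mul_comm l]
  rw [lintegral_congr_ae (hpos.mono hrep), lintegral_const_mul' _ _ ENNReal.ofReal_ne_top,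
    lintegral_lintegral_swap (by fun_prop), setLIntegral_congr_fun measurableSet_Ioi hinner]
  exact ENNReal.mul_ne_top ENNReal.ofReal_ne_top
    (integrableOn_rpow_mul_exp_neg_rpow (by linarith) hβ).lintegral_lt_top.ne

/-- Negative `β`-th power of a `β`-stable variable. -/
lemma exists_linearNearZero_stable (hβ : 0 < β) (hβ1 : β < 1) (hpos : ∀ᵐ s ∂ν, 0 < s)
    (hlap : ∀ l, 0 < l → ∫ s, Real.exp (-l * s) ∂ν = Real.exp (-l ^ β)) :
    ∃ a A, LinearNearZero ν (fun s => s ^ (-β)) a A := by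
  obtain ⟨c, hc, hcl⟩ := exists_le_stable_tail hβ hβ1 hpos hlap
  have hpow (δ : ℝ) (hδ : 0 < δ) : (δ ^ (1 / β)) ^ β = δ := by
    rw [← Real.rpow_mul hδ.le, one_div_mul_cancel hβ.ne', Real.rpow_one]
  have hset (δ : ℝ) (hδ : 0 < δ) : ν {s | s ^ (-β) ≤ δ} =
      ENNReal.ofReal (ν.real {s | 1 ≤ δ ^ (1 / β) * s}) := by
    rw [ofReal_measureReal]
    refine measure_congr ?_
    filter_upwards [hpos] with s hs
    have hm : 0 < δ ^ (1 / β) := by positivity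
    refine propext ?_
    change s ^ (-β) ≤ δ ↔ 1 ≤ δ ^ (1 / β) * s
    rw [← inv_le_iff_one_le_mul₀' hm, ← Real.rpow_le_rpow_iff_of_neg hs (inv_pos.mpr hm)
      (neg_neg_of_pos hβ), Real.rpow_neg (inv_nonneg.mpr hm.le), Real.inv_rpow hm.le, inv_inv,
      hpow δ hδ]
  refine ⟨c, 2, by fun_prop, ?_, hc, two_pos, fun δ hδ => ?_, fun δ hδ hδ1 => ?_,
    stable_negative_moment_ne_top hβ hpos hlap⟩
  · filter_upwards [hpos] with s hs
    positivity
  · rw [hset δ hδ]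
    refine ENNReal.ofReal_le_ofReal ?_
    simpa only [hpow δ hδ] using stable_tail_le hpos hlap (l := δ ^ (1 / β)) (by positivity)
  · rw [hset δ hδ]
    refine ENNReal.ofReal_le_ofReal ?_
    simpa only [hpow δ hδ] using hcl (δ ^ (1 / β)) (by positivity)
      (Real.rpow_le_one hδ.le hδ1 (by positivity))

end

lemma one_add_rpow_neg_bounds {w e : ℝ} (hw : 0 < w) (he : 0 < e) :
    2 ^ (-e) * min 1 (w ^ (-e)) ≤ (1 + w) ^ (-e) ∧ (1 + w) ^ (-e) ≤ min 1 (w ^ (-e)) := by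
  constructor
  · rcases le_total w 1 with h | h
    · calc _ ≤ (2 : ℝ) ^ (-e) * 1 := by gcongr; exact min_le_left _ _
        _ ≤ _ := by
          rw [mul_one]
          exact Real.rpow_le_rpow_of_nonpos (by positivity) (by linarith) (by linarith)
    · calc _ ≤ (2 : ℝ) ^ (-e) * w ^ (-e) := by gcongr; exact min_le_right _ _
        _ = (2 * w) ^ (-e) := (Real.mul_rpow (by norm_num) hw.le).symm
        _ ≤ _ := Real.rpow_le_rpow_of_nonpos (by positivity) (by linarith) (by linarith)
  · exact le_min (Real.rpow_le_one_of_one_le_of_nonpos (by linarith) (by linarith))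
      (Real.rpow_le_rpow_of_nonpos hw (by linarith) (by linarith))

lemma mul_jump_kernel_eq {α β d t s D : ℝ} (hα : 0 < α) (ht : 0 < t) (hs : 0 < s) (hD : 0 < D) :
    t ^ (β - 1) * s ^ (-β) * (((t / s) ^ β) ^ (-(d / α)) *
      min 1 ((D / ((t / s) ^ β) ^ (1 / α)) ^ (-(d + α)))) =
    t ^ (β - 1 - β * d / α) * jumpProfile (d / α) (t ^ β / D ^ α) (s ^ (-β)) := by
  have hw : (D / ((t / s) ^ β) ^ (1 / α)) ^ (-(d + α)) =
      (t ^ β / D ^ α * s ^ (-β)) ^ (d / α + 1) := by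
    have h1 : -(d + α) = (-α) * (d / α + 1) := by field_simp
    rw [h1, Real.rpow_mul (by positivity)]
    congr 1
    rw [Real.div_rpow hD.le (by positivity), ← Real.rpow_mul (by positivity),
      Real.div_rpow ht.le hs.le, Real.rpow_neg hD.le, Real.rpow_neg hs.le,
      show 1 / α * -α = -1 by field_simp, Real.rpow_neg_one]
    field_simp
  have hr : t ^ (β - 1) * s ^ (-β) * ((t / s) ^ β) ^ (-(d / α)) =
      t ^ (β - 1 - β * d / α) * (s ^ (-β)) ^ (1 - d / α) := by
    rw [← Real.rpow_mul (by positivity), Real.div_rpow ht.le hs.le, div_eq_mul_inv,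
      ← Real.rpow_neg hs.le, ← Real.rpow_mul hs.le, mul_mul_mul_comm, ← Real.rpow_add ht,
      ← Real.rpow_add hs]
    congr 2 <;> ring
  rw [hw, jumpProfile, ← mul_assoc, hr, mul_assoc]

lemma Hle_eq_mul_growthProfile {α β d t D : ℝ} (hα : 0 < α) (ht : 0 < t) (hD : 0 < D) :
    Hle α β d t D = t ^ (β - 1 - β * d / α) * growthProfile (d / α) (t ^ β / D ^ α) := by
  unfold Hle growthProfile
  have h1 : d / α < 2 ↔ d < 2 * α := div_lt_iff₀ hα
  have h2 : d / α = 2 ↔ d = 2 * α := div_eq_iff hα.ne'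
  simp only [h1, h2]
  split_ifs with h3 h4
  · rw [mul_one]
  · subst h4
    rw [mul_div_assoc]
    congr 2
    field_simp
    ring
  · rw [Real.div_rpow (by positivity) (by positivity), ← Real.rpow_mul ht.le,
      ← Real.rpow_mul hD.le, div_eq_mul_inv (t ^ (_ : ℝ)), ← Real.rpow_neg hD.le, ← mul_assoc,
      ← Real.rpow_add ht]
    congr 2 <;> field_simp <;> ring

lemma rpow_mul_dist_rpow_eq {α β d t D : ℝ} (hα : 0 < α) (ht : 0 < t) (hD : 0 < D) :
    t ^ (2 * β - 1) * D ^ (-d - α) =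
      t ^ (β - 1 - β * d / α) * (t ^ β / D ^ α) ^ (d / α + 1) := by
  rw [Real.div_rpow (by positivity) (by positivity), ← Real.rpow_mul ht.le,
    ← Real.rpow_mul hD.le, div_eq_mul_inv (t ^ (_ : ℝ)), ← Real.rpow_neg hD.le, ← mul_assoc,
    ← Real.rpow_add ht]
  congr 2 <;> field_simp <;> ring

lemma lintegral_comp_div_rpow {β t : ℝ} (hβ : 0 < β) (ht : 0 < t) (G : ℝ → ℝ≥0∞) :
    ∫⁻ r in Ioi 0, G r =
      ∫⁻ s in Ioi 0, ENNReal.ofReal (β * t ^ β * s ^ (-β - 1)) * G ((t / s) ^ β) := by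
  have himg : (fun s : ℝ => (t / s) ^ β) '' Ioi 0 = Ioi 0 := by
    ext r
    constructor
    · rintro ⟨s, hs, rfl⟩
      have : 0 < s := hs
      exact Real.rpow_pos_of_pos (by positivity) _
    · intro hr
      have hr : 0 < r := hr
      refine ⟨t / r ^ (1 / β), mem_Ioi.mpr (by positivity), ?_⟩
      simp only
      rw [div_div_cancel₀ ht.ne', ← Real.rpow_mul hr.le, one_div_mul_cancel hβ.ne', Real.rpow_one]
  have hinj : InjOn (fun s : ℝ => (t / s) ^ β) (Ioi 0) := by
    intro s hs s' hs' h
    have hs : 0 < s := hs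
    have hs' : 0 < s' := hs'
    have h2 := (Real.rpow_left_inj (by positivity) (by positivity) hβ.ne').mp h
    field_simp at h2
    exact h2.symm
  have hderiv : ∀ s ∈ Ioi (0 : ℝ), HasDerivWithinAt (fun s : ℝ => (t / s) ^ β)
      (t ^ β * (-β * s ^ (-β - 1))) (Ioi 0) s := by
    intro s hs
    have h1 := ((Real.hasDerivAt_rpow_const (p := -β) (Or.inl (ne_of_gt hs))).const_mul
      (t ^ β)).hasDerivWithinAt (s := Ioi 0)
    refine h1.congr_of_mem (fun x hx => ?_) hs
    have hx : 0 < x := hx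
    rw [Real.div_rpow ht.le hx.le, Real.rpow_neg hx.le, div_eq_mul_inv]
  conv_lhs => rw [← himg]
  rw [lintegral_image_eq_lintegral_abs_deriv_mul measurableSet_Ioi hderiv hinj]
  refine setLIntegral_congr_fun measurableSet_Ioi fun s hs => ?_
  have hs : 0 < s := hs
  have hnn : 0 ≤ β * t ^ β * s ^ (-β - 1) := by positivity
  congr 2
  rw [show t ^ β * (-β * s ^ (-β - 1)) = -(β * t ^ β * s ^ (-β - 1)) by ring, abs_neg,
    abs_of_nonneg hnn]

/-- The subordinated kernel as a mean over the subordinator at unit time. -/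
lemma lintegral_subordination_eq {β t : ℝ} (hβ : 0 < β) (ht : 0 < t) {pbar : ℝ → ℝ → ℝ}
    (hnn : ∀ s, 0 ≤ pbar 1 s) (hmeas : Measurable (pbar 1)) {ν : Measure ℝ}
    (hdens : ν = (volume.restrict (Ioi 0)).withDensity fun s => ENNReal.ofReal (pbar 1 s))
    (hscale : ∀ s, 0 < s → pbar ((t / s) ^ β) t = s / t * pbar 1 s)
    {p : ℝ → ℝ} :
    ∫⁻ r in Ioi 0, ENNReal.ofReal (p r * pbar r t) =
      ∫⁻ s, ENNReal.ofReal (β * (t ^ (β - 1) * s ^ (-β) * p ((t / s) ^ β))) ∂ν := by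
  rw [lintegral_comp_div_rpow hβ ht, hdens, lintegral_withDensity_eq_lintegral_mul_non_measurable _
    hmeas.ennreal_ofReal (ae_of_all _ fun _ => ENNReal.ofReal_lt_top)]
  refine setLIntegral_congr_fun measurableSet_Ioi fun s hs => ?_
  have hs : 0 < s := hs
  simp only [Pi.mul_apply]
  rw [← ENNReal.ofReal_mul (by positivity), ← ENNReal.ofReal_mul (hnn s), hscale s hs]
  congr 1
  rw [Real.rpow_sub hs, Real.rpow_sub ht, Real.rpow_one, Real.rpow_one]
  field_simp

lemma lintegral_jump_kernel_bounds {ν : Measure ℝ} {β : ℝ}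
    (hpos : ∀ᵐ s ∂ν, 0 < s) (hβ : 0 < β)
    {α d t D C₀ : ℝ} (hα : 0 < α) (hd : 0 < d) (ht : 0 < t) (hD : 0 < D) (hC₀ : 1 ≤ C₀)
    {p : ℝ → ℝ}
    (hp : ∀ r, 0 < r →
      C₀⁻¹ * (r ^ (-(d / α)) * (1 + D / r ^ (1 / α)) ^ (-d - α)) ≤ p r ∧
      p r ≤ C₀ * (r ^ (-(d / α)) * (1 + D / r ^ (1 / α)) ^ (-d - α))) :
    ENNReal.ofReal (C₀⁻¹ * 2 ^ (-(d + α)) * β * t ^ (β - 1 - β * d / α)) *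
        ∫⁻ s, ENNReal.ofReal (jumpProfile (d / α) (t ^ β / D ^ α) (s ^ (-β))) ∂ν ≤
      ∫⁻ s, ENNReal.ofReal (β * (t ^ (β - 1) * s ^ (-β) * p ((t / s) ^ β))) ∂ν ∧
    ∫⁻ s, ENNReal.ofReal (β * (t ^ (β - 1) * s ^ (-β) * p ((t / s) ^ β))) ∂ν ≤
      ENNReal.ofReal (C₀ * β * t ^ (β - 1 - β * d / α)) *
        ∫⁻ s, ENNReal.ofReal (jumpProfile (d / α) (t ^ β / D ^ α) (s ^ (-β))) ∂ν := by
  have he : -d - α = -(d + α) := by ring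
  have hC : 0 < C₀ := by linarith
  constructor
  · rw [← lintegral_const_mul' _ _ ENNReal.ofReal_ne_top]
    refine lintegral_mono_ae (hpos.mono fun s hs => ?_)
    rw [← ENNReal.ofReal_mul (by positivity)]
    refine ENNReal.ofReal_le_ofReal ?_
    rw [mul_assoc _ (t ^ (β - 1 - β * d / α)), ← mul_jump_kernel_eq hα ht hs hD]
    have hr : 0 < (t / s) ^ β := by positivity
    have hw : 0 < D / ((t / s) ^ β) ^ (1 / α) := by positivity
    have h1 := (one_add_rpow_neg_bounds hw (by positivity : 0 < d + α)).1
    have h2 := (hp _ hr).1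
    rw [he] at h2
    calc _ = β * (t ^ (β - 1) * s ^ (-β) * (C₀⁻¹ * (((t / s) ^ β) ^ (-(d / α)) *
          (2 ^ (-(d + α)) * min 1 ((D / ((t / s) ^ β) ^ (1 / α)) ^ (-(d + α))))))) := by ring
      _ ≤ β * (t ^ (β - 1) * s ^ (-β) * (C₀⁻¹ * (((t / s) ^ β) ^ (-(d / α)) *
          (1 + D / ((t / s) ^ β) ^ (1 / α)) ^ (-(d + α))))) := by gcongr
      _ ≤ _ := by gcongr
  · rw [← lintegral_const_mul' _ _ ENNReal.ofReal_ne_top]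
    refine lintegral_mono_ae (hpos.mono fun s hs => ?_)
    rw [← ENNReal.ofReal_mul (by positivity)]
    refine ENNReal.ofReal_le_ofReal ?_
    rw [mul_assoc _ (t ^ (β - 1 - β * d / α)), ← mul_jump_kernel_eq hα ht hs hD]
    have hr : 0 < (t / s) ^ β := by positivity
    have hw : 0 < D / ((t / s) ^ β) ^ (1 / α) := by positivity
    have h1 := (one_add_rpow_neg_bounds hw (by positivity : 0 < d + α)).2
    have h2 := (hp _ hr).2
    rw [he] at h2
    calc _ ≤ β * (t ^ (β - 1) * s ^ (-β) * (C₀ * (((t / s) ^ β) ^ (-(d / α)) *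
          (1 + D / ((t / s) ^ β) ^ (1 / α)) ^ (-(d + α))))) := by gcongr
      _ ≤ β * (t ^ (β - 1) * s ^ (-β) * (C₀ * (((t / s) ^ β) ^ (-(d / α)) *
          min 1 ((D / ((t / s) ^ β) ^ (1 / α)) ^ (-(d + α)))))) := by gcongr
      _ = _ := by ring

lemma ofReal_bounds_of_factor {m M C₁ C b P G : ℝ} {F Q : ℝ≥0∞} (hm : 0 < m) (hb : 0 < b)
    (hP : 0 < P) (hM : 0 < M) (hG : 0 ≤ G)
    (h1 : ENNReal.ofReal (m * b * P) * F ≤ Q) (h2 : Q ≤ ENNReal.ofReal (M * b * P) * F)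
    (hF : ENNReal.ofReal (C₁⁻¹ * G) ≤ F ∧ F ≤ ENNReal.ofReal (C₁ * G))
    (hCm : C⁻¹ ≤ m * b * C₁⁻¹) (hCM : M * b * C₁ ≤ C) :
    ENNReal.ofReal (C⁻¹ * (P * G)) ≤ Q ∧ Q ≤ ENNReal.ofReal (C * (P * G)) := by
  constructor
  · calc _ ≤ ENNReal.ofReal (m * b * C₁⁻¹ * (P * G)) := by gcongr
      _ = ENNReal.ofReal (m * b * P) * ENNReal.ofReal (C₁⁻¹ * G) := by
        rw [← ENNReal.ofReal_mul (by positivity)]; congr 1; ring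
      _ ≤ _ := le_trans (by gcongr; exact hF.1) h1
  · calc Q ≤ ENNReal.ofReal (M * b * P) * ENNReal.ofReal (C₁ * G) :=
        h2.trans (by gcongr; exact hF.2)
      _ = ENNReal.ofReal (M * b * C₁ * (P * G)) := by
        rw [← ENNReal.ofReal_mul (by positivity)]; congr 1; ring
      _ ≤ _ := by gcongr

/-- Theorem 1.4(i): β-stable time-change of a jump-type kernel on a
`d`-regular space.  If `p⁰(t,x,y) ≍ t^{−d/α}(1 + d(x,y)/t^{1/α})^{−d−α}` and
`q(t,x,y) = ∫₀^∞ p⁰(r,x,y) p̄(r,t) dr`, where `p̄` are the densities of a β-stable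
subordinator, then `q(t,x,y) ≍ H_{≤1}(t,d(x,y))` for `d(x,y) ≤ t^{β/α}` and
`q(t,x,y) ≍ t^{2β−1} d(x,y)^{−d−α}` for `d(x,y) ≥ t^{β/α}`. -/
theorem time_frac_stmt18
    {E : Type*} [MetricSpace E] [MeasurableSpace E] [BorelSpace E]
    [TopologicalSpace.SeparableSpace E] [LocallyCompactSpace E]
    (μ : Measure E)
    (d : ℝ) (hd : 0 < d) (cμ : ℝ) (hcμ : 1 ≤ cμ)
    (hvol : ∀ (x : E) (r : ℝ), 0 < r →
      ENNReal.ofReal (cμ⁻¹ * r ^ d) ≤ μ (Metric.ball x r) ∧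
      μ (Metric.ball x r) ≤ ENNReal.ofReal (cμ * r ^ d))
    (α β : ℝ) (hα : 0 < α) (hβ : 0 < β ∧ β < 1)
    -- the β-stable subordinator marginals with continuous densities
    (μr : ℝ → Measure ℝ)
    (hprob : ∀ r : ℝ, 0 < r → IsProbabilityMeasure (μr r))
    (hlap : ∀ r : ℝ, 0 < r → ∀ l : ℝ, 0 < l →
      ∫ s, Real.exp (-l * s) ∂(μr r) = Real.exp (-r * l ^ β))
    (pbar : ℝ → ℝ → ℝ)
    (hpbar_nn : ∀ r t : ℝ, 0 ≤ pbar r t)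
    (hpbar_cont : ∀ r : ℝ, 0 < r → Continuous (pbar r))
    (hdens : ∀ r : ℝ, 0 < r → ∀ A : Set ℝ, MeasurableSet A →
      μr r A = ∫⁻ t in A ∩ Set.Ici 0, ENNReal.ofReal (pbar r t))
    -- the jump-type two-sided estimate for p⁰
    (p0 : ℝ → E → E → ℝ)
    (hp0_nn : ∀ (r : ℝ) (x y : E), 0 ≤ p0 r x y)
    (hp0_meas : Measurable (fun z : ℝ × E × E => p0 z.1 z.2.1 z.2.2))
    (C₀ : ℝ) (hC₀ : 1 ≤ C₀)
    (hp0 : ∀ t : ℝ, 0 < t → ∀ x y : E,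
      C₀⁻¹ * (t ^ (-(d / α)) * (1 + dist x y / t ^ (1/α)) ^ (-d - α)) ≤ p0 t x y ∧
      p0 t x y ≤ C₀ * (t ^ (-(d / α)) * (1 + dist x y / t ^ (1/α)) ^ (-d - α)))
    -- the fundamental solution q
    (q : ℝ → E → E → ℝ≥0∞)
    (hq : ∀ (t : ℝ) (x y : E),
      q t x y = ∫⁻ r in Set.Ioi (0:ℝ), ENNReal.ofReal (p0 r x y * pbar r t)) :
    ∃ C : ℝ, 1 ≤ C ∧
      ∀ t : ℝ, 0 < t → ∀ x y : E, x ≠ y →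
        (dist x y ≤ t ^ (β / α) →
          ENNReal.ofReal (C⁻¹ * Hle α β d t (dist x y)) ≤ q t x y ∧
          q t x y ≤ ENNReal.ofReal (C * Hle α β d t (dist x y))) ∧
        (t ^ (β / α) ≤ dist x y →
          ENNReal.ofReal (C⁻¹ * (t ^ (2 * β - 1) * dist x y ^ (-d - α))) ≤ q t x y ∧
          q t x y ≤ ENNReal.ofReal (C * (t ^ (2 * β - 1) * dist x y ^ (-d - α)))) := by
  obtain ⟨hβ0, hβ1⟩ := hβ
  have hprob1 := hprob 1 one_pos
  have hdens1 : μr 1 =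
      (volume.restrict (Ioi 0)).withDensity fun s => ENNReal.ofReal (pbar 1 s) := by
    ext A hA
    rw [hdens 1 one_pos A hA, withDensity_apply _ hA, Measure.restrict_restrict hA]
    exact setLIntegral_congr ((ae_eq_refl A).inter Ioi_ae_eq_Ici.symm)
  have hpos : ∀ᵐ s ∂(μr 1), 0 < s := by
    rw [hdens1]
    exact (withDensity_absolutelyContinuous _ _).ae_le (ae_restrict_mem measurableSet_Ioi)
  obtain ⟨a, A, hlin⟩ := exists_linearNearZero_stable hβ0 hβ1 hpos fun l hl => by
    rw [hlap 1 one_pos l hl, neg_one_mul]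
  obtain ⟨C₁, hC₁, hF⟩ := hlin.exists_two_sided (div_pos hd hα)
  have hC₀0 : 0 < C₀ := by linarith
  have hC₁0 : 0 < C₁ := by linarith
  have h2 : (1 : ℝ) ≤ 2 ^ (d + α) := Real.one_le_rpow (by norm_num) (by positivity)
  have hβinv : 1 ≤ β⁻¹ := one_le_inv_iff₀.mpr ⟨hβ0, hβ1.le⟩
  have hC : 1 ≤ C₀ * 2 ^ (d + α) * β⁻¹ * C₁ :=
    one_le_mul_of_one_le_of_one_le
      (one_le_mul_of_one_le_of_one_le (one_le_mul_of_one_le_of_one_le hC₀ h2) hβinv) hC₁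
  refine ⟨_, hC, fun t ht x y hxy => ?_⟩
  have hD : 0 < dist x y := dist_pos.mpr hxy
  obtain ⟨hlow, hupp⟩ := lintegral_jump_kernel_bounds hpos hβ0 hα hd ht hD hC₀
    fun r hr => hp0 r hr x y
  rw [← lintegral_subordination_eq hβ0 ht (hpbar_nn 1) (hpbar_cont 1 one_pos).measurable hdens1
    (fun s hs => stable_density_scaling hprob hlap hpbar_nn hpbar_cont hdens ht hs)
    (p := fun r => p0 r x y), ← hq] at hlow hupp
  have hCm : (C₀ * 2 ^ (d + α) * β⁻¹ * C₁)⁻¹ ≤ C₀⁻¹ * 2 ^ (-(d + α)) * β * C₁⁻¹ := by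
    rw [Real.rpow_neg (by norm_num), mul_inv, mul_inv, mul_inv, inv_inv]
  have hCM : C₀ * β * C₁ ≤ C₀ * 2 ^ (d + α) * β⁻¹ * C₁ := by
    have hle : β ≤ 2 ^ (d + α) * β⁻¹ :=
      hβ1.le.trans (one_le_mul_of_one_le_of_one_le h2 hβinv)
    rw [mul_assoc C₀ (_ ^ _)]
    exact mul_le_mul_of_nonneg_right (mul_le_mul_of_nonneg_left hle hC₀0.le) hC₁0.le
  have hpow : (t ^ (β / α)) ^ α = t ^ β := by
    rw [← Real.rpow_mul ht.le, div_mul_cancel₀ _ hα.ne']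
  have hN : 0 < t ^ β / dist x y ^ α := by positivity
  constructor
  · intro hle
    have hN1 : 1 ≤ t ^ β / dist x y ^ α := by
      rw [one_le_div (by positivity), ← hpow]
      gcongr
    rw [Hle_eq_mul_growthProfile hα ht hD]
    have hG := half_le_growthProfile (k := d / α) hN1
    exact ofReal_bounds_of_factor (by positivity) hβ0 (by positivity) hC₀0
      (by linarith) hlow hupp ((hF _ hN).1 hN1) hCm hCM
  · intro hle
    have hN1 : t ^ β / dist x y ^ α ≤ 1 := by
      rw [div_le_one (by positivity), ← hpow]
      gcongr
    rw [rpow_mul_dist_rpow_eq hα ht hD]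
    exact ofReal_bounds_of_factor (by positivity) hβ0 (by positivity) hC₀0
      (by positivity) hlow hupp ((hF _ hN).2 hN1) hCm hCM
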